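/- arXiv:2002.00268 — 2 statements merged into one kernel-verified Lean document; each statement's English description precedes it below -/
import Mathlib

section
/- Let n ∈ ℕ and let I be a C^∞-radical ideal of C^∞(ℝ^n). Then for every f ∈ C^∞(ℝ^n): the class f + I is invertible in the quotient ring C^∞(ℝ^n)/I if and only if there exists φ ∈ I such that f(x) ≠ 0 for every x ∈ Z(φ). -/
noncomputable section

/-- The ring `C^∞(ℝ^n)` of infinitely differentiable functions `ℝ^n → ℝ`, as a subring of
the ring of all functions `ℝ^n → ℝ` with pointwise operations. -/
def CinfN (n : ℕ) : Subring ((Fin n → ℝ) → ℝ) where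
  carrier := {f | ContDiff ℝ (⊤ : ℕ∞) f}
  zero_mem' := show ContDiff ℝ (⊤ : ℕ∞) (fun _ => (0:ℝ)) from contDiff_const
  one_mem' := show ContDiff ℝ (⊤ : ℕ∞) (fun _ => (1:ℝ)) from contDiff_const
  add_mem' := fun {a b} (hf : ContDiff ℝ (⊤ : ℕ∞) a) (hg : ContDiff ℝ (⊤ : ℕ∞) b) => hf.add hg
  mul_mem' := fun {a b} (hf : ContDiff ℝ (⊤ : ℕ∞) a) (hg : ContDiff ℝ (⊤ : ℕ∞) b) => hf.mul hg
  neg_mem' := fun {a} (hf : ContDiff ℝ (⊤ : ℕ∞) a) => hf.neg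

/-- The zeroset of a smooth function on `ℝ^n`. -/
def ZN {n : ℕ} (f : CinfN n) : Set (Fin n → ℝ) := {x | (f : (Fin n → ℝ) → ℝ) x = 0}

/-- An ideal `I ⊆ C^∞(ℝ^n)` is `C^∞`-radical iff it contains every function whose zeroset
contains the zeroset of some member of `I`. -/
def IsCinfRadicalN {n : ℕ} (I : Ideal (CinfN n)) : Prop :=
  ∀ g : CinfN n, (∃ f ∈ I, ZN f ⊆ ZN g) → g ∈ I

end

/-- For a `C^∞`-radical ideal `I ⊆ C^∞(ℝ^n)` and `f ∈ C^∞(ℝ^n)`: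
`f + I` is invertible in `C^∞(ℝ^n)/I` iff there is `φ ∈ I` with `f` nonvanishing on `Z(φ)`. -/
theorem statement1 (n : ℕ) (I : Ideal (CinfN n)) (hI : IsCinfRadicalN I) (f : CinfN n) :
    IsUnit (Ideal.Quotient.mk I f) ↔
      ∃ φ ∈ I, ∀ x ∈ ZN φ, (f : (Fin n → ℝ) → ℝ) x ≠ 0 := by
  constructor
  · intro h
    obtain ⟨b, hb⟩ := h.exists_right_inv
    obtain ⟨g, rfl⟩ := Ideal.Quotient.mk_surjective b
    rw [← map_mul, ← map_one (Ideal.Quotient.mk I), Ideal.Quotient.eq] at hb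
    refine ⟨f * g - 1, hb, ?_⟩
    intro x hx hf
    have hx' : (f : (Fin n → ℝ) → ℝ) x * (g : (Fin n → ℝ) → ℝ) x - 1 = 0 := hx
    rw [hf] at hx'
    norm_num at hx'
  · rintro ⟨φ, hφ, h⟩
    have hne : ∀ x, (f : (Fin n → ℝ) → ℝ) x * (f : (Fin n → ℝ) → ℝ) x
        + (φ : (Fin n → ℝ) → ℝ) x * (φ : (Fin n → ℝ) → ℝ) x ≠ 0 := by
      intro x hx
      have h1 : (φ : (Fin n → ℝ) → ℝ) x = 0 := by
        nlinarith [mul_self_nonneg ((f : (Fin n → ℝ) → ℝ) x),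
          mul_self_nonneg ((φ : (Fin n → ℝ) → ℝ) x)]
      have h2 : (f : (Fin n → ℝ) → ℝ) x = 0 := by
        rw [h1] at hx
        simpa using hx
      exact h x h1 h2
    have hf : ContDiff ℝ (⊤ : ℕ∞) (f : (Fin n → ℝ) → ℝ) := f.2
    have hp : ContDiff ℝ (⊤ : ℕ∞) (φ : (Fin n → ℝ) → ℝ) := φ.2
    let d : CinfN n := ⟨fun x => ((f : (Fin n → ℝ) → ℝ) x * (f : (Fin n → ℝ) → ℝ) x
        + (φ : (Fin n → ℝ) → ℝ) x * (φ : (Fin n → ℝ) → ℝ) x)⁻¹,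
        ((hf.mul hf).add (hp.mul hp)).inv hne⟩
    have hd : (f * f + φ * φ) * d = 1 := by
      apply Subtype.ext
      funext x
      exact mul_inv_cancel₀ (hne x)
    have key : Ideal.Quotient.mk I f * Ideal.Quotient.mk I (f * d) = 1 := by
      rw [← map_mul, ← map_one (Ideal.Quotient.mk I), Ideal.Quotient.eq]
      have : f * (f * d) - 1 = (-(φ * d)) * φ := by
        rw [← hd]; ring
      rw [this]
      exact I.mul_mem_left _ hφ
    exact IsUnit.of_mul_eq_one _ key
end

section
/- Let E be an arbitrary set and let I be a C^∞-radical ideal of C^∞(ℝ^E). Then the canonical relation ≺ on the quotient ring C^∞(ℝ^E)/I is transitive: for all f, g, h ∈ C^∞(ℝ^E), if f + I ≺ g + I and g + I ≺ h + I, then f + I ≺ h + I. -/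
noncomputable section

open Set

/-- The continuous linear "restriction" map `ℝ^t → ℝ^s` for `s ⊆ t`. -/
def restrCLM {E : Type} (s t : Finset E) (h : s ⊆ t) : (↥t → ℝ) →L[ℝ] (↥s → ℝ) :=
  LinearMap.toContinuousLinearMap
    (LinearMap.funLeft ℝ ℝ (fun i : ↥s => (⟨i.1, h i.2⟩ : ↥t)))

/-- A function `f : ℝ^E → ℝ` is (`C^∞`-)smooth iff it factors through the projection onto
finitely many coordinates via an infinitely differentiable function. -/
def IsCinf {E : Type} (f : (E → ℝ) → ℝ) : Prop :=
  ∃ (s : Finset E) (g : (↥s → ℝ) → ℝ),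
    ContDiff ℝ (⊤ : ℕ∞) g ∧ ∀ v : E → ℝ, f v = g (fun i => v i.1)

theorem IsCinf.enlarge {E : Type} {f : (E → ℝ) → ℝ} {s : Finset E} {g : (↥s → ℝ) → ℝ}
    (hg : ContDiff ℝ (⊤ : ℕ∞) g) (hfg : ∀ v, f v = g (fun i => v i.1))
    (t : Finset E) (hst : s ⊆ t) :
    ∃ g' : (↥t → ℝ) → ℝ, ContDiff ℝ (⊤ : ℕ∞) g' ∧ ∀ v, f v = g' (fun i => v i.1) := by
  refine ⟨g ∘ restrCLM s t hst, hg.comp (restrCLM s t hst).contDiff, fun v => ?_⟩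
  have h1 : (restrCLM s t hst) (fun i : ↥t => v i.1) = fun i : ↥s => v i.1 := rfl
  simp only [Function.comp_apply, h1]
  exact hfg v

/-- The ring `C^∞(ℝ^E)` of smooth functions `ℝ^E → ℝ`, as a subring of the ring of all
functions `ℝ^E → ℝ` with pointwise operations. -/
def Cinf (E : Type) : Subring ((E → ℝ) → ℝ) where
  carrier := {f | IsCinf f}
  zero_mem' := ⟨∅, fun _ => 0, contDiff_const, fun _ => rfl⟩
  one_mem' := ⟨∅, fun _ => 1, contDiff_const, fun _ => rfl⟩
  neg_mem' := by
    rintro f ⟨s, g, hg, hfg⟩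
    exact ⟨s, -g, hg.neg, fun v => by simp [hfg v]⟩
  add_mem' := by
    rintro f₁ f₂ ⟨s, g₁, hg₁, hfg₁⟩ ⟨t, g₂, hg₂, hfg₂⟩
    haveI := Classical.decEq E
    obtain ⟨g₁', hg₁', hfg₁'⟩ := IsCinf.enlarge hg₁ hfg₁ (s ∪ t) Finset.subset_union_left
    obtain ⟨g₂', hg₂', hfg₂'⟩ := IsCinf.enlarge hg₂ hfg₂ (s ∪ t) Finset.subset_union_right
    exact ⟨s ∪ t, g₁' + g₂', hg₁'.add hg₂', fun v => by
      simp only [Pi.add_apply, hfg₁' v, hfg₂' v]⟩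
  mul_mem' := by
    rintro f₁ f₂ ⟨s, g₁, hg₁, hfg₁⟩ ⟨t, g₂, hg₂, hfg₂⟩
    haveI := Classical.decEq E
    obtain ⟨g₁', hg₁', hfg₁'⟩ := IsCinf.enlarge hg₁ hfg₁ (s ∪ t) Finset.subset_union_left
    obtain ⟨g₂', hg₂', hfg₂'⟩ := IsCinf.enlarge hg₂ hfg₂ (s ∪ t) Finset.subset_union_right
    exact ⟨s ∪ t, g₁' * g₂', hg₁'.mul hg₂', fun v => by
      simp only [Pi.mul_apply, hfg₁' v, hfg₂' v]⟩

/-- The zeroset of a smooth function on `ℝ^E`. -/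
def Z {E : Type} (f : Cinf E) : Set (E → ℝ) := {v | (f : (E → ℝ) → ℝ) v = 0}

/-- An ideal `I ⊆ C^∞(ℝ^E)` is `C^∞`-radical iff it contains every function whose zeroset
contains the zeroset of some member of `I`. -/
def IsCinfRadical {E : Type} (I : Ideal (Cinf E)) : Prop :=
  ∀ g : Cinf E, (∃ f ∈ I, Z f ⊆ Z g) → g ∈ I

/-- The collection of zerosets of `ℝ^E`. -/
def zeroSets (E : Type) : Set (Set (E → ℝ)) := {X | ∃ f : Cinf E, X = Z f}

/-- A filter of zerosets of `ℝ^E`. -/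
def IsZFilter {E : Type} (Φ : Set (Set (E → ℝ))) : Prop :=
  Φ ⊆ zeroSets E ∧ (Set.univ : Set (E → ℝ)) ∈ Φ ∧
    (∀ F ∈ Φ, ∀ G ∈ Φ, F ∩ G ∈ Φ) ∧
    (∀ F ∈ Φ, ∀ H ∈ zeroSets E, F ⊆ H → H ∈ Φ)

/-- `Ŝ`: the set of zerosets of members of a set `S ⊆ C^∞(ℝ^E)`. -/
def hatSet {E : Type} (S : Set (Cinf E)) : Set (Set (E → ℝ)) := {X | ∃ f ∈ S, X = Z f}

/-- `Î`: the set of zerosets of members of the ideal `I`. -/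
def hatI {E : Type} (I : Ideal (Cinf E)) : Set (Set (E → ℝ)) := hatSet (I : Set (Cinf E))

/-- `Φ̌`: the set of smooth functions whose zeroset belongs to `Φ`. -/
def checkSet {E : Type} (Φ : Set (Set (E → ℝ))) : Set (Cinf E) := {f : Cinf E | Z f ∈ Φ}

end

theorem IsCinf.comp_pos {E : Type} (p : Cinf E) (hp : ∀ v, 0 < (p : (E → ℝ) → ℝ) v)
    (φ : ℝ → ℝ) (hφ : ∀ x : ℝ, 0 < x → ContDiffAt ℝ (⊤ : ℕ∞) φ x) :
    IsCinf (fun v => φ ((p : (E → ℝ) → ℝ) v)) := by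
  classical
  obtain ⟨s, g, hg, hpg⟩ := p.2
  refine ⟨s, fun w => φ (g w), ?_, fun v => congrArg φ (hpg v)⟩
  rw [contDiff_iff_contDiffAt]
  intro w
  have hw : 0 < g w := by
    have h1 := hp (fun e => if he : e ∈ s then w ⟨e, he⟩ else 0)
    rw [hpg] at h1
    have h2 : (fun i : ↥s => (fun e => if he : e ∈ s then w ⟨e, he⟩ else (0 : ℝ)) i.1) = w := by
      funext i
      simp
    rwa [h2] at h1
  exact (hφ _ hw).comp w hg.contDiffAt

/-- For a `C^∞`-radical ideal `I ⊆ C^∞(ℝ^E)`, the canonical relation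
`≺` on `C^∞(ℝ^E)/I` is transitive. -/
theorem statement14 (E : Type) (I : Ideal (Cinf E)) (hI : IsCinfRadical I)
    (f g h : Cinf E)
    (hfg : ∃ u : Cinf E, IsUnit (Ideal.Quotient.mk I u) ∧ (g - f) - u ^ 2 ∈ I)
    (hgh : ∃ u : Cinf E, IsUnit (Ideal.Quotient.mk I u) ∧ (h - g) - u ^ 2 ∈ I) :
    ∃ u : Cinf E, IsUnit (Ideal.Quotient.mk I u) ∧ (h - f) - u ^ 2 ∈ I := by
  obtain ⟨u, hu, hu2⟩ := hfg
  obtain ⟨w, hw, hw2⟩ := hgh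
  obtain ⟨c, hc⟩ := hu.exists_right_inv
  obtain ⟨u', rfl⟩ := Ideal.Quotient.mk_surjective c
  have ha : u * u' - 1 ∈ I := by
    rw [← Ideal.Quotient.eq, map_mul, hc, map_one]
  let a : Cinf E := u * u' - 1
  let p : Cinf E := u ^ 2 + w ^ 2 + a ^ 2
  have hp : ∀ v, 0 < (p : (E → ℝ) → ℝ) v := by
    intro v
    have e : (p : (E → ℝ) → ℝ) v = (u : (E → ℝ) → ℝ) v ^ 2 + (w : (E → ℝ) → ℝ) v ^ 2
        + ((u : (E → ℝ) → ℝ) v * (u' : (E → ℝ) → ℝ) v - 1) ^ 2 := rfl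
    rw [e]
    by_cases h0 : (u : (E → ℝ) → ℝ) v = 0
    · rw [h0]
      nlinarith [sq_nonneg ((w : (E → ℝ) → ℝ) v)]
    · positivity
  let x : Cinf E := ⟨_, IsCinf.comp_pos p hp Real.sqrt
    (fun y hy => Real.contDiffAt_sqrt hy.ne')⟩
  let y : Cinf E := ⟨_, IsCinf.comp_pos p hp (fun t => (Real.sqrt t)⁻¹)
    (fun y hy => (Real.contDiffAt_sqrt hy.ne').inv (Real.sqrt_pos.2 hy).ne')⟩
  have hx2 : x ^ 2 = p := by
    apply Subtype.ext
    funext v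
    exact Real.sq_sqrt (hp v).le
  have hxy : x * y = 1 := by
    apply Subtype.ext
    funext v
    exact mul_inv_cancel₀ (Real.sqrt_pos.2 (hp v)).ne'
  refine ⟨x, (IsUnit.of_mul_eq_one y hxy).map _, ?_⟩
  rw [hx2]
  have e : h - f - p = (g - f - u ^ 2) + (h - g - w ^ 2) - a * a := by
    simp only [p]
    ring
  rw [e]
  exact I.sub_mem (I.add_mem hu2 hw2) (I.mul_mem_left a ha)
end
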